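/- Jump normal form theorem: A partial function F :⊆ ℕ^ℕ → ℕ^ℕ on Baire space is limit computable if and only if there exists a computable partial function G :⊆ ℕ^ℕ → ℕ^ℕ such that F = G ∘ J, where J is the Turing jump operator. -/

import Mathlib

open scoped Classical

namespace LimitComp

/-- Baire space `ℕ^ℕ`. -/
abbrev Baire : Type := ℕ → ℕ

/-- The finite prefix of length `k` of a point of Baire space. -/
def pre (p : Baire) (k : ℕ) : List ℕ := List.ofFn fun i : Fin k => p i

/-- Interleaving pairing `⟨q,p⟩(2n) = q(n)`, `⟨q,p⟩(2n+1) = p(n)`. -/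
def pairB (q p : Baire) : Baire := fun n => if n % 2 = 0 then q (n / 2) else p (n / 2)

/-- The `i`-th component of a tupling `⟨p₀,p₁,p₂,...⟩`. -/
def seqOf (p : Baire) (i : ℕ) : Baire := fun n => p (Nat.pair i n)

/-- Tupling `⟨p₀,p₁,p₂,...⟩` of a sequence of points of Baire space. -/
def tup (ps : ℕ → Baire) : Baire := fun m => ps m.unpair.1 m.unpair.2

/-- The limit map `lim :⊆ ℕ^ℕ → ℕ^ℕ`; it maps `⟨p₀,p₁,p₂,...⟩` to its pointwise
limit, which is defined whenever every coordinate is eventually constant. -/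
noncomputable def limB : Baire →. Baire := fun p =>
  ⟨∀ n, ∃ i₀, ∀ i, i₀ ≤ i → seqOf p i n = seqOf p i₀ n,
   fun h n => seqOf p (Classical.choose (h n)) n⟩

/-- Monotonicity of a finite approximation function under prefix extension
(this corresponds to a one-way output tape). -/
def PrefixMono (η : List ℕ → ℕ → Option ℕ) : Prop :=
  ∀ u v n y, u <+: v → η u n = some y → η v n = some y

/-- `η` approximates the partial function `F`: for every input in the domain of `F`
every output position is eventually filled with the correct output value. -/
def OneWayApprox (η : List ℕ → ℕ → Option ℕ) (F : Baire →. Baire) : Prop :=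
  ∀ p q, q ∈ F p → ∀ n, ∃ k, η (pre p k) n = some (q n)

/-- Computability for partial functions on Baire space: `F` is computed by a
Turing machine with one-way output tape, formalized via a computable monotone
finite approximation function. -/
def ComputableFn (F : Baire →. Baire) : Prop :=
  ∃ η : List ℕ → ℕ → Option ℕ, Computable₂ η ∧ PrefixMono η ∧ OneWayApprox η F

/-- `η` is a limit approximation of `F`: on every input in the domain of `F`,
every output cell eventually stabilizes to the correct output value. -/
def LimitApprox (η : List ℕ → ℕ → ℕ) (F : Baire →. Baire) : Prop :=
  ∀ p q, q ∈ F p → ∀ n, ∃ k₀, ∀ k, k₀ ≤ k → η (pre p k) n = q n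

/-- Limit computability for partial functions on Baire space: `F` is computed by
a Turing machine with a two-way output tape such that on inputs in the domain
every output cell eventually stabilizes. -/
def LimitComputableFn (F : Baire →. Baire) : Prop :=
  ∃ η : List ℕ → ℕ → ℕ, Computable₂ η ∧ LimitApprox η F

/-- The `i`-th Turing machine halts on input `p ∈ ℕ^ℕ` (i.e. it halts after
having read some finite prefix of `p`). -/
def haltsOn (i : ℕ) (p : Baire) : Prop :=
  ∃ k, ((Denumerable.ofNat Nat.Partrec.Code i).eval (Encodable.encode (pre p k))).Dom

/-- The Turing jump operator `J : ℕ^ℕ → ℕ^ℕ`. -/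
noncomputable def jump (p : Baire) : Baire := fun i => if haltsOn i p then 1 else 0

/-- The halting problem `0'`. -/
noncomputable def zero' : Baire := jump fun _ => 0

/-- `F` is computable relative to the oracle `q`. -/
def ComputableRel (q : Baire) (F : Baire →. Baire) : Prop :=
  ∃ G : Baire →. Baire, ComputableFn G ∧ ∀ p r, r ∈ F p → r ∈ G (pairB q p)

/-- `F` is limit computable relative to the oracle `q`. -/
def LimitComputableRel (q : Baire) (F : Baire →. Baire) : Prop :=
  ∃ G : Baire →. Baire, LimitComputableFn G ∧ ∀ p r, r ∈ F p → r ∈ G (pairB q p)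

/-- Turing reducibility for points of Baire space. -/
def TuringLe (p q : Baire) : Prop :=
  ∃ F : Baire →. Baire, ComputableFn F ∧ p ∈ F q

end LimitComp

namespace LimitComp

theorem pre_eq_take {p : Baire} {j k : ℕ} (h : j ≤ k) : pre p j = (pre p k).take j := by
  apply List.ext_getElem?
  intro i
  simp only [pre, List.getElem?_take, List.getElem?_ofFn]
  grind

theorem getElem?_pre {p : Baire} {n k : ℕ} (h : n < k) : (pre p k)[n]? = some (p n) := by
  simp [pre, h]

/-- The halting behaviour of any uniformly computable family of tests on finite prefixes
is recorded by the jump, at primitive recursive indices. -/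
theorem exists_haltsOn_iff {T : ℕ → List ℕ → Bool} (hT : Computable₂ T) :
    ∃ d : ℕ → ℕ, Primrec d ∧ ∀ a p, haltsOn (d a) p ↔ ∃ k, T a (pre p k) = true := by
  let g : ℕ → Option ℕ := fun x =>
    bif T (Denumerable.ofNat (ℕ × List ℕ) x).1 (Denumerable.ofNat (ℕ × List ℕ) x).2
      then some 0 else none
  have hx : Computable (Denumerable.ofNat (ℕ × List ℕ)) := Computable.ofNat _
  have hg : Computable g := Computable.cond
    (hT.comp (Computable.fst.comp hx) (Computable.snd.comp hx))
    (Computable.const _) (Computable.const _)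
  obtain ⟨c, hc⟩ := Nat.Partrec.Code.exists_code.1 (Partrec.nat_iff.1 hg.ofOption)
  refine ⟨fun a => Encodable.encode (c.curry a), ?_, fun a p => ?_⟩
  · exact Primrec.encode.comp (Nat.Partrec.Code.primrec₂_curry.comp (Primrec.const c) Primrec.id)
  · refine exists_congr fun k => ?_
    have e : Nat.pair a (Encodable.encode (pre p k)) = Encodable.encode (a, pre p k) := rfl
    rw [Denumerable.ofNat_encode, Nat.Partrec.Code.eval_curry, hc, e]
    simp only [g, Denumerable.ofNat_encode]
    cases T a (pre p k) <;> simp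

theorem jump_eq_zero_iff {p : Baire} {i : ℕ} : jump p i = 0 ↔ ¬ haltsOn i p := by
  simp [jump]

theorem jump_injective : Function.Injective jump := by
  intro p q h
  let T : ℕ → List ℕ → Bool := fun a w => decide (w[a.unpair.1]? = some a.unpair.2)
  have hT : Computable₂ T := (PrimrecPred.decide (Primrec.eq.comp
    (Primrec.list_getElem?.comp Primrec.snd
      (Primrec.fst.comp (Primrec.unpair.comp Primrec.fst)))
    (Primrec.option_some.comp
      (Primrec.snd.comp (Primrec.unpair.comp Primrec.fst))))).to_comp
  obtain ⟨d, -, hd⟩ := exists_haltsOn_iff hT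
  funext n
  have hp : haltsOn (d (Nat.pair n (p n))) p :=
    (hd _ _).2 ⟨n + 1, by simp [T, getElem?_pre (Nat.lt_succ_self n)]⟩
  have hq : haltsOn (d (Nat.pair n (p n))) q := by
    by_contra hn
    rw [← jump_eq_zero_iff, ← h, jump_eq_zero_iff] at hn
    exact hn hp
  obtain ⟨k, hk⟩ := (hd _ _).1 hq
  simp only [T, Nat.unpair_pair, decide_eq_true_eq, pre, List.getElem?_ofFn] at hk
  grind

/-- Search through the prefix `u` for the least `m` such that position `d n m` of `u` is either
unknown or known to be `0`. -/
def firstZero (d : ℕ → ℕ → ℕ) (u : List ℕ) (n : ℕ) : ℕ :=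
  (List.range u.length).findIdx fun m => (u[d n m]?).getD 0 == 0

/-- The witness found by `firstZero`, with its second component as the output, provided that
the position is known. -/
def zeroSearch (d : ℕ → ℕ → ℕ) (u : List ℕ) (n : ℕ) : Option ℕ :=
  if u[d n (firstZero d u n)]? = some 0 then some (firstZero d u n).unpair.2 else none

theorem zeroSearch_computable {d : ℕ → ℕ → ℕ} (hd : Primrec₂ d) :
    Computable₂ (zeroSearch d) := by
  have hf : Primrec fun x : List ℕ × ℕ => firstZero d x.1 x.2 := by
    refine Primrec.list_findIdx (Primrec.list_range.comp (Primrec.list_length.comp Primrec.fst)) ?_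
    refine Primrec.beq.comp (Primrec.option_getD.comp (Primrec.list_getElem?.comp
      (Primrec.fst.comp Primrec.fst) (hd.comp (Primrec.snd.comp Primrec.fst) Primrec.snd))
      (Primrec.const 0)) (Primrec.const 0)
  exact (Primrec.ite (Primrec.eq.comp (Primrec.list_getElem?.comp Primrec.fst
    (hd.comp Primrec.snd hf)) (Primrec.const _))
    (Primrec.option_some.comp (Primrec.snd.comp (Primrec.unpair.comp hf)))
    (Primrec.const none)).to_comp

theorem firstZero_eq {d : ℕ → ℕ → ℕ} {u : List ℕ} {n m : ℕ} (hm : m ≤ u.length)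
    (h0 : u[d n m]? = some 0) (hlt : ∀ j < m, (u[d n j]?).getD 0 ≠ 0) :
    firstZero d u n = m := by
  rcases hm.lt_or_eq with hm | rfl
  · rw [firstZero, List.findIdx_eq (by simpa using hm)]
    simp only [List.getElem_range, h0]
    exact ⟨by simp, fun j hj => by simpa using hlt j hj⟩
  · rw [firstZero, List.findIdx_eq_length.2, List.length_range]
    intro j hj
    simpa using hlt j (by simpa using hj)

theorem zeroSearch_eq_some_iff {d : ℕ → ℕ → ℕ} {u : List ℕ} {n y : ℕ} :
    zeroSearch d u n = some y ↔ ∃ m ≤ u.length, u[d n m]? = some 0 ∧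
      (∀ j < m, (u[d n j]?).getD 0 ≠ 0) ∧ m.unpair.2 = y := by
  constructor
  · intro h
    refine ⟨firstZero d u n, ?_, ?_, fun j hj => ?_, ?_⟩
    · simpa [firstZero] using
        List.findIdx_le_length (xs := List.range u.length)
          (p := fun m => (u[d n m]?).getD 0 == 0)
    · by_contra hn
      simp [zeroSearch, hn] at h
    · have := List.not_of_lt_findIdx hj
      simpa using this
    · unfold zeroSearch at h
      split_ifs at h
      exact Option.some.inj h
  · rintro ⟨m, hm, h0, hlt, rfl⟩
    simp [zeroSearch, firstZero_eq hm h0 hlt, h0]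

theorem zeroSearch_prefixMono (d : ℕ → ℕ → ℕ) : PrefixMono (zeroSearch d) := by
  intro u v n y huv h
  rw [zeroSearch_eq_some_iff] at h ⊢
  obtain ⟨m, hm, h0, hlt, hy⟩ := h
  have ext : ∀ i a : ℕ, u[i]? = some a → v[i]? = some a := by
    obtain ⟨t, rfl⟩ := huv
    intro i a h
    rw [List.getElem?_append_left (List.getElem?_eq_some_iff.1 h).1, h]
  refine ⟨m, hm.trans huv.length_le, ext _ _ h0, fun j hj => ?_, hy⟩
  have := hlt j hj
  cases hu : u[d n j]? with
  | none => simp [hu] at this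
  | some a => simpa [ext _ _ hu, hu] using this

theorem exists_zeroSearch_eq (d : ℕ → ℕ → ℕ) (r : Baire) (n : ℕ) (h : ∃ m, r (d n m) = 0) :
    ∃ m k, r (d n m) = 0 ∧ zeroSearch d (pre r k) n = some m.unpair.2 := by
  classical
  let m := Nat.find h
  let k := m + ∑ j ∈ Finset.range (m + 1), (d n j + 1)
  have hk : ∀ j ≤ m, d n j < k := fun j hj => by
    have := Finset.single_le_sum (f := fun j => d n j + 1) (fun _ _ => Nat.zero_le _)
      (show j ∈ Finset.range (m + 1) from Finset.mem_range_succ_iff.2 hj)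
    simp only [k] at this ⊢
    omega
  refine ⟨m, k, Nat.find_spec h, zeroSearch_eq_some_iff.2 ⟨m, by simp [pre, k], ?_, ?_, rfl⟩⟩
  · rw [getElem?_pre (hk m le_rfl), Nat.find_spec h]
  · intro j hj
    rw [getElem?_pre (hk j hj.le)]
    exact Nat.find_min h hj

theorem LimitComputableFn.exists_computableFn_jump {F : Baire →. Baire}
    (hF : LimitComputableFn F) :
    ∃ G : Baire →. Baire, ComputableFn G ∧ ∀ p, F p = G (jump p) := by
  obtain ⟨η, hη, hlim⟩ := hF
  let T : ℕ → List ℕ → Bool := fun a w =>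
    decide (a.unpair.2.unpair.1 ≤ w.length) && !(η w a.unpair.1 == a.unpair.2.unpair.2)
  have hT : Computable₂ T := by
    have h1 : Primrec fun x : ℕ × List ℕ => x.1.unpair.1 :=
      Primrec.fst.comp (Primrec.unpair.comp Primrec.fst)
    have h2 : Primrec fun x : ℕ × List ℕ => x.1.unpair.2.unpair :=
      Primrec.unpair.comp (Primrec.snd.comp (Primrec.unpair.comp Primrec.fst))
    refine Primrec.and.to_comp.comp ?_ (Primrec.not.to_comp.comp
      (Primrec.beq.to_comp.comp (hη.comp Computable.snd h1.to_comp) (Primrec.snd.comp h2).to_comp))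
    exact (PrimrecPred.decide (Primrec.nat_le.comp (Primrec.fst.comp h2)
      (Primrec.list_length.comp Primrec.snd))).to_comp
  obtain ⟨d, hd, hdT⟩ := exists_haltsOn_iff hT
  have hzero : ∀ p n k y, jump p (d (Nat.pair n (Nat.pair k y))) = 0 ↔
      ∀ j ≥ k, η (pre p j) n = y := by
    intro p n k y
    rw [jump_eq_zero_iff, hdT]
    simp [T, pre]
  let f : Baire → Part Baire := F
  refine ⟨Function.extend jump f fun _ => Part.none, ?_,
    fun p => (jump_injective.extend_apply f _ p).symm⟩
  refine ⟨zeroSearch fun n m => d (Nat.pair n m), zeroSearch_computable (hd.comp Primrec₂.natPair),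
    zeroSearch_prefixMono _, fun r q hq n => ?_⟩
  change q ∈ (Function.extend jump f fun _ => Part.none : Baire → Part Baire) r at hq
  by_cases hr : ∃ p, jump p = r
  swap
  · rw [Function.extend_apply' _ _ _ hr] at hq
    exact (Part.notMem_none _ hq).elim
  obtain ⟨p, rfl⟩ := hr
  rw [jump_injective.extend_apply] at hq
  obtain ⟨k₀, hk₀⟩ := hlim p q hq n
  obtain ⟨m, k, hm, hk⟩ := exists_zeroSearch_eq (fun n m => d (Nat.pair n m)) (jump p) n
    ⟨Nat.pair k₀ (q n), (hzero _ _ _ _).2 hk₀⟩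
  refine ⟨k, hk.trans ?_⟩
  rw [← Nat.pair_unpair m, hzero] at hm
  rw [← hm _ (le_max_left _ k₀), hk₀ _ (le_max_right _ _)]

/-- The machine with index `i` is seen to halt on a proper prefix of `w` within `w.length`
steps. -/
def HaltsWithin (w : List ℕ) (i : ℕ) : Prop :=
  ∃ k < w.length, (Nat.Partrec.Code.evaln w.length (Denumerable.ofNat Nat.Partrec.Code i)
    (Encodable.encode (w.take k))).isSome = true

/-- The approximation to the jump computed from the prefix `w`. -/
noncomputable def jumpStage (w : List ℕ) : List ℕ :=
  (List.range w.length).map fun i => if HaltsWithin w i then 1 else 0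

theorem primrecRel_haltsWithin : PrimrecRel HaltsWithin := by
  have : PrimrecRel fun (k : ℕ) (x : List ℕ × ℕ) =>
      (Nat.Partrec.Code.evaln x.1.length (Denumerable.ofNat Nat.Partrec.Code x.2)
        (Encodable.encode (x.1.take k))).isSome = true := by
    refine Primrec.eq.comp (Primrec.option_isSome.comp (Nat.Partrec.Code.primrec_evaln.comp
      (Primrec.pair (Primrec.pair ?_ ?_) ?_))) (Primrec.const true)
    · exact Primrec.list_length.comp (Primrec.fst.comp Primrec.snd)
    · exact (Primrec.ofNat _).comp (Primrec.snd.comp Primrec.snd)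
    · exact Primrec.encode.comp (Primrec.list_take.comp Primrec.fst (Primrec.fst.comp Primrec.snd))
  have h : PrimrecPred fun x : List ℕ × ℕ => HaltsWithin x.1 x.2 :=
    (this.exists_mem_list.comp (Primrec.list_range.comp (Primrec.list_length.comp Primrec.fst))
      Primrec.id).of_eq fun x => by simp [HaltsWithin]
  exact h

theorem primrec_jumpStage : Primrec jumpStage :=
  Primrec.list_map (Primrec.list_range.comp Primrec.list_length)
    (Primrec.ite primrecRel_haltsWithin (Primrec.const 1) (Primrec.const 0))

theorem HaltsWithin.haltsOn {p : Baire} {k i : ℕ} (h : HaltsWithin (pre p k) i) :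
    haltsOn i p := by
  obtain ⟨j, hj, h⟩ := h
  have hjk : j ≤ k := by simpa [pre] using hj.le
  obtain ⟨y, hy⟩ := Option.isSome_iff_exists.1 h
  refine ⟨j, ?_⟩
  rw [pre_eq_take hjk]
  exact Part.dom_iff_mem.2 ⟨y, Nat.Partrec.Code.evaln_sound hy⟩

theorem haltsOn.eventually_haltsWithin {p : Baire} {i : ℕ} (h : haltsOn i p) :
    ∀ᶠ k in Filter.atTop, HaltsWithin (pre p k) i := by
  obtain ⟨j, h⟩ := h
  obtain ⟨y, hy⟩ := Part.dom_iff_mem.1 h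
  obtain ⟨s, hs⟩ := Nat.Partrec.Code.evaln_complete.1 hy
  filter_upwards [Filter.eventually_gt_atTop j, Filter.eventually_ge_atTop s] with k hj hk
  refine ⟨j, by simpa [pre] using hj, Option.isSome_iff_exists.2 ⟨y, ?_⟩⟩
  rw [← pre_eq_take hj.le]
  exact Nat.Partrec.Code.evaln_mono (by simpa [pre] using hk) hs

theorem eventually_haltsWithin_iff (p : Baire) (i : ℕ) :
    ∀ᶠ k in Filter.atTop, (HaltsWithin (pre p k) i ↔ haltsOn i p) := by
  by_cases h : haltsOn i p
  · filter_upwards [h.eventually_haltsWithin] with k hk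
    exact iff_of_true hk h
  · exact Filter.Eventually.of_forall fun k => ⟨HaltsWithin.haltsOn, fun h' => (h h').elim⟩

theorem eventually_pre_jump_isPrefix (p : Baire) (j : ℕ) :
    ∀ᶠ k in Filter.atTop, pre (jump p) j <+: jumpStage (pre p k) := by
  have h := (Finset.range j).eventually_all.2 fun i _ => eventually_haltsWithin_iff p i
  filter_upwards [h, Filter.eventually_ge_atTop j] with k hk hj
  rw [List.prefix_iff_eq_take]
  apply List.ext_getElem
  · simp [pre, jumpStage, hj]
  · intro i h1 h2
    have hi : i < j := by simpa [pre] using h1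
    have := hk i (Finset.mem_range.2 hi)
    simp [pre, jumpStage, jump] at this ⊢
    simp only [this]

theorem ComputableFn.limitComputableFn_comp_jump {G : Baire →. Baire} (hG : ComputableFn G) :
    LimitComputableFn fun p => G (jump p) := by
  obtain ⟨η, hη, hmono, happ⟩ := hG
  refine ⟨fun w n => (η (jumpStage w) n).getD 0, ?_, fun p q hq n => ?_⟩
  · exact Computable.option_getD
      (hη.comp (primrec_jumpStage.to_comp.comp Computable.fst) Computable.snd) (Computable.const 0)
  · obtain ⟨j, hj⟩ := happ _ _ hq n
    obtain ⟨k₀, hk₀⟩ := Filter.eventually_atTop.1 (eventually_pre_jump_isPrefix p j)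
    exact ⟨k₀, fun k hk => by simp [hmono _ _ _ _ (hk₀ k hk) hj]⟩

/-- **Jump normal form theorem.** A partial function `F :⊆ ℕ^ℕ → ℕ^ℕ` is limit
computable if and only if there exists a computable partial function
`G :⊆ ℕ^ℕ → ℕ^ℕ` such that `F = G ∘ J`, where `J` is the Turing jump operator. -/
theorem jump_normal_form (F : Baire →. Baire) :
    LimitComputableFn F ↔
      ∃ G : Baire →. Baire, ComputableFn G ∧ ∀ p, F p = G (jump p) := by
  refine ⟨LimitComputableFn.exists_computableFn_jump, ?_⟩
  rintro ⟨G, hG, hFG⟩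
  rw [show F = fun p => G (jump p) from funext hFG]
  exact hG.limitComputableFn_comp_jump

end LimitComp
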